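/- arXiv:math/9706219 — 4 statements merged into one kernel-verified Lean document; each statement's English description precedes it below -/
import Mathlib

section
/- For any Ferrers board B contained in an n×n grid, the number of n×n matrices over the finite field F_q of rank k whose entries outside B are all zero equals (q-1)^k · q^{Area(B)-k} · R_k(B; q^{-1}), where R_k(B;q) = Σ_C q^{inv(C,B)} is the Garsia–Remmel q-rook polynomial summed over placements C of k non-attacking rooks on B. -/
open Finset
open scoped Classical

noncomputable section

variable {R : Type*} [CommRing R]

/-- The q-integer `[m]_q = 1 + q + ... + q^{m-1}`. -/
def qint (q : R) (m : ℕ) : R := ∑ i ∈ Finset.range m, q ^ i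

/-- The q-factorial `[m]_q!`. -/
def qfact (q : R) (m : ℕ) : R := ∏ i ∈ Finset.range m, qint q (i + 1)

/-- A Ferrers board inside the `n × n` grid, given by column heights `c`:
square `(i,j)` (0-based row `i`, column `j`) belongs to the board iff `i < c j`. -/
def IsFerrers (n : ℕ) (c : Fin n → ℕ) : Prop := Monotone c ∧ ∀ j, c j ≤ n

/-- The squares of the Ferrers board with column heights `c`. -/
def boardSq (n : ℕ) (c : Fin n → ℕ) : Finset (Fin n × Fin n) :=
  Finset.univ.filter fun s => (s.1 : ℕ) < c s.2

/-- A set of rooks is non-attacking when no two share a row or a column. -/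
def NonAttacking {n : ℕ} (C : Finset (Fin n × Fin n)) : Prop :=
  ∀ r ∈ C, ∀ r' ∈ C, r ≠ r' → r.1 ≠ r'.1 ∧ r.2 ≠ r'.2

/-- Placements of `k` non-attacking rooks on the Ferrers board. -/
def placements (n : ℕ) (c : Fin n → ℕ) (k : ℕ) : Finset (Finset (Fin n × Fin n)) :=
  Finset.univ.filter fun C => C.card = k ∧ C ⊆ boardSq n c ∧ NonAttacking C

/-- `inv(C,B)`: the number of squares of the board that do not contain a rook and
are not above (smaller row index, same column) nor to the right of (same row,
larger column index) any rook of `C`. -/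
def rookInv (n : ℕ) (c : Fin n → ℕ) (C : Finset (Fin n × Fin n)) : ℕ :=
  ((boardSq n c).filter fun s => s ∉ C ∧ ∀ r ∈ C,
    ¬(r.2 = s.2 ∧ s.1 < r.1) ∧ ¬(r.1 = s.1 ∧ r.2 < s.2)).card

/-- The Garsia–Remmel q-rook polynomial `R_k(B;q)`. -/
def qRook (q : R) (n : ℕ) (c : Fin n → ℕ) (k : ℕ) : R :=
  ∑ C ∈ placements n c k, q ^ rookInv n c C

/-- The polynomial (in `x`) `∑_{j=0}^n [j]_q! R_{n-j}(B;q) ∏_{i=j+1}^n (x - q^i)`. -/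
def hitGen (q : R) (n : ℕ) (c : Fin n → ℕ) : Polynomial R :=
  ∑ j ∈ Finset.range (n + 1),
    Polynomial.C (qfact q j * qRook q n c (n - j)) *
      ∏ i ∈ Finset.Icc (j + 1) n, (Polynomial.X - Polynomial.C (q ^ i))

/-- The Garsia–Remmel q-hit polynomial `T_k(B;q)`, defined by
`∑_{j=0}^n [j]_q! R_{n-j}(B;q) ∏_{i=j+1}^n (x - q^i) = ∑_k T_k(B;q) x^k`. -/
def qHit (q : R) (n : ℕ) (c : Fin n → ℕ) (k : ℕ) : R := (hitGen q n c).coeff k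

/-- Placements of `n` non-attacking rooks on the full `n × n` grid with exactly
`k` rooks on the board. -/
def fullPlacements (n : ℕ) (c : Fin n → ℕ) (k : ℕ) : Finset (Finset (Fin n × Fin n)) :=
  Finset.univ.filter fun C => C.card = n ∧ NonAttacking C ∧ (C ∩ boardSq n c).card = k

end

/-- The number of `n × n` matrices over `F_q` of rank `k` supported on the board. -/
noncomputable def matCount (F : Type*) [Field F] [Fintype F] (n : ℕ) (c : Fin n → ℕ)
    (k : ℕ) : ℕ :=
  Nat.card {A : Matrix (Fin n) (Fin n) F //
    A.rank = k ∧ ∀ i j : Fin n, ¬ ((i : ℕ) < c j) → A i j = 0}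

section RookSide

/-- All placements of non-attacking rooks on the board with column heights `c`. -/
noncomputable def allPlacements (n : ℕ) (c : Fin n → ℕ) : Finset (Finset (Fin n × Fin n)) :=
  Finset.univ.filter fun C => C ⊆ boardSq n c ∧ NonAttacking C

/-- The rows among the first `h` that contain no rook of `C`. -/
noncomputable def freeRows {n : ℕ} (h : ℕ) (C : Finset (Fin n × Fin n)) : Finset (Fin n) :=
  Finset.univ.filter fun i => (i : ℕ) < h ∧ ∀ r ∈ C, r.1 ≠ i

theorem mem_boardSq {n : ℕ} {c : Fin n → ℕ} {s : Fin n × Fin n} :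
    s ∈ boardSq n c ↔ (s.1 : ℕ) < c s.2 := by
  simp [boardSq]

theorem snd_lt_of_mem_boardSq {n : ℕ} {d : Fin n → ℕ} {j₀ : Fin n}
    (hd : ∀ j, j₀ ≤ j → d j = 0) {s : Fin n × Fin n} (hs : s ∈ boardSq n d) : s.2 < j₀ := by
  by_contra hlt
  rw [mem_boardSq, hd _ (not_lt.mp hlt)] at hs
  omega

theorem boardSq_update {n : ℕ} {d : Fin n → ℕ} {j₀ : Fin n} (hd : ∀ j, j₀ ≤ j → d j = 0)
    (h : ℕ) : boardSq n (Function.update d j₀ h) = boardSq n d ∪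
      (Finset.univ.filter fun i : Fin n => (i : ℕ) < h).map
        (Function.Embedding.sectL (Fin n) j₀) := by
  ext ⟨i, j⟩
  simp only [mem_union, mem_boardSq, mem_map, mem_filter, mem_univ, true_and,
    Function.Embedding.sectL_apply, Prod.mk.injEq]
  by_cases hj : j = j₀
  · subst hj
    simp [hd j le_rfl]
  · simp [Function.update_of_ne hj, Ne.symm hj]

theorem rookInv_update {n : ℕ} {d : Fin n → ℕ} {j₀ : Fin n} (hd : ∀ j, j₀ ≤ j → d j = 0)
    (h : ℕ) (C : Finset (Fin n × Fin n)) :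
    rookInv n (Function.update d j₀ h) C = rookInv n d C +
      (Finset.univ.filter fun i : Fin n => (i : ℕ) < h ∧ (i, j₀) ∉ C ∧ ∀ r ∈ C,
        ¬(r.2 = j₀ ∧ i < r.1) ∧ ¬(r.1 = i ∧ r.2 < j₀)).card := by
  unfold rookInv
  rw [boardSq_update hd, filter_union, card_union_of_disjoint, filter_map, card_map, filter_filter]
  · rfl
  · refine disjoint_filter_filter (disjoint_left.mpr ?_)
    intro s hs hs'
    obtain ⟨i, -, rfl⟩ := mem_map.mp hs'
    exact lt_irrefl _ (snd_lt_of_mem_boardSq hd hs)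

theorem rookInv_update_of_subset {n : ℕ} {d : Fin n → ℕ} {j₀ : Fin n}
    (hd : ∀ j, j₀ ≤ j → d j = 0) (h : ℕ) {C : Finset (Fin n × Fin n)} (hC : C ⊆ boardSq n d) :
    rookInv n (Function.update d j₀ h) C = rookInv n d C + (freeRows h C).card := by
  have hlt : ∀ r ∈ C, r.2 < j₀ := fun r hr => snd_lt_of_mem_boardSq hd (hC hr)
  rw [rookInv_update hd]
  congr 2
  ext i
  simp only [freeRows, mem_filter, mem_univ, true_and, and_congr_right_iff]
  intro _
  refine ⟨fun H r hr e => (H.2 r hr).2 ⟨e, hlt r hr⟩, fun H => ⟨fun hi => H _ hi rfl, fun r hr =>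
    ⟨fun e => (hlt r hr).ne e.1, fun e => H r hr e.1⟩⟩⟩

theorem rookInv_update_insert {n : ℕ} {d : Fin n → ℕ} {j₀ : Fin n}
    (hd : ∀ j, j₀ ≤ j → d j = 0) (h : ℕ) {C : Finset (Fin n × Fin n)} (hC : C ⊆ boardSq n d)
    (i : Fin n) :
    rookInv n (Function.update d j₀ h) (insert (i, j₀) C) =
      rookInv n d C + ((freeRows h C).filter fun i' => i < i').card := by
  have hlt : ∀ r ∈ C, r.2 < j₀ := fun r hr => snd_lt_of_mem_boardSq hd (hC hr)
  rw [rookInv_update hd]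
  congr 1
  · unfold rookInv
    congr 1
    refine filter_congr fun s hs => ?_
    have hs' := snd_lt_of_mem_boardSq hd hs
    have hne : s ≠ (i, j₀) := fun e => hs'.ne (congrArg Prod.snd e)
    simp [hne, hs'.ne', hs'.le]
  · congr 1
    ext i'
    simp only [freeRows, filter_filter, mem_filter, mem_univ, true_and, mem_insert, Prod.mk.injEq,
      and_true, forall_eq_or_imp, lt_irrefl, and_false, not_false_eq_true, not_lt, not_or]
    constructor
    · rintro ⟨h1, ⟨h2, h3⟩, h4, h5⟩
      exact ⟨⟨h1, fun r hr e => (h5 r hr).2 ⟨e, hlt r hr⟩⟩, lt_of_le_of_ne h4 (Ne.symm h2)⟩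
    · rintro ⟨⟨h1, h2⟩, h3⟩
      exact ⟨h1, ⟨h3.ne', fun hi => h2 _ hi rfl⟩, h3.le, fun r hr =>
        ⟨fun e => (hlt r hr).ne e.1, fun e => h2 r hr e.1⟩⟩

theorem nonAttacking_insert {n : ℕ} {C : Finset (Fin n × Fin n)} {s : Fin n × Fin n}
    (hC : NonAttacking C) (hs : ∀ r ∈ C, r.1 ≠ s.1 ∧ r.2 ≠ s.2) : NonAttacking (insert s C) := by
  intro r hr r' hr' hne
  rcases mem_insert.mp hr with e | hr <;> rcases mem_insert.mp hr' with e' | hr'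
  · exact absurd (e.trans e'.symm) hne
  · exact e ▸ ⟨(hs r' hr').1.symm, (hs r' hr').2.symm⟩
  · exact e' ▸ hs r hr
  · exact hC r hr r' hr' hne

theorem NonAttacking.mono {n : ℕ} {C D : Finset (Fin n × Fin n)} (hD : NonAttacking D)
    (h : C ⊆ D) : NonAttacking C :=
  fun r hr r' hr' => hD r (h hr) r' (h hr')

theorem sum_allPlacements_update {M : Type*} [AddCommMonoid M] {n : ℕ} {d : Fin n → ℕ}
    {j₀ : Fin n} (hd : ∀ j, j₀ ≤ j → d j = 0) (h : ℕ) (G : Finset (Fin n × Fin n) → M) :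
    ∑ C ∈ allPlacements n (Function.update d j₀ h), G C =
      ∑ C ∈ allPlacements n d, (G C + ∑ i ∈ freeRows h C, G (insert (i, j₀) C)) := by
  have hle : boardSq n d ⊆ boardSq n (Function.update d j₀ h) := by
    rw [boardSq_update hd]; exact subset_union_left
  rw [← sum_filter_add_sum_filter_not _ (fun C => ∀ r ∈ C, r.2 ≠ j₀), sum_add_distrib]
  congr 1
  · refine sum_congr ?_ fun _ _ => rfl
    ext C
    simp only [allPlacements, mem_filter, mem_univ, true_and]
    constructor
    · rintro ⟨⟨h1, h2⟩, h3⟩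
      refine ⟨fun r hr => ?_, h2⟩
      have := h1 hr
      rwa [mem_boardSq, Function.update_of_ne (h3 r hr), ← mem_boardSq] at this
    · rintro ⟨h1, h2⟩
      exact ⟨⟨h1.trans hle, h2⟩, fun r hr => (snd_lt_of_mem_boardSq hd (h1 hr)).ne⟩
  · rw [sum_sigma']
    symm
    refine sum_bij (fun x _ => insert (x.2, j₀) x.1) ?_ ?_ ?_ fun _ _ => rfl
    · rintro ⟨C, i⟩ hx
      simp only [mem_sigma, allPlacements, freeRows, mem_filter, mem_univ, true_and] at hx ⊢
      obtain ⟨⟨h1, h2⟩, h3, h4⟩ := hx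
      refine ⟨⟨insert_subset ?_ (h1.trans hle), nonAttacking_insert h2 fun r hr =>
        ⟨h4 r hr, (snd_lt_of_mem_boardSq hd (h1 hr)).ne⟩⟩, fun H => H _ (mem_insert_self _ _) rfl⟩
      simpa [mem_boardSq] using h3
    · rintro ⟨C, i⟩ hx ⟨C', i'⟩ hx' e
      simp only [mem_sigma, allPlacements, freeRows, mem_filter, mem_univ, true_and] at hx hx' e
      have hC : ∀ a, (a, j₀) ∉ C := fun a ha => lt_irrefl _ (snd_lt_of_mem_boardSq hd (hx.1.1 ha))
      have hC' : ∀ a, (a, j₀) ∉ C' :=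
        fun a ha => lt_irrefl _ (snd_lt_of_mem_boardSq hd (hx'.1.1 ha))
      have hi : i = i' := by
        have : (i, j₀) ∈ insert (i', j₀) C' := e ▸ mem_insert_self _ _
        simpa [hC'] using this
      subst hi
      have : C = C' := by rw [← erase_insert (hC i), e, erase_insert (hC' i)]
      rw [this]
    · intro C hC
      simp only [allPlacements, mem_filter, mem_univ, true_and, not_forall, not_not] at hC
      obtain ⟨⟨h1, h2⟩, ⟨i, j⟩, h3, h4⟩ := hC
      obtain rfl : j = j₀ := h4
      refine ⟨⟨C.erase (i, j), i⟩, ?_, insert_erase h3⟩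
      simp only [mem_sigma, allPlacements, freeRows, mem_filter, mem_univ, true_and, mem_erase]
      refine ⟨⟨fun r hr => ?_, h2.mono (erase_subset _ _)⟩, ?_, fun r hr => (h2 r hr.2 _ h3 hr.1).1⟩
      · obtain ⟨hr1, hr2⟩ := mem_erase.mp hr
        have := h1 hr2
        rwa [mem_boardSq, Function.update_of_ne (h2 r hr2 _ h3 hr1).2, ← mem_boardSq] at this
      · simpa [mem_boardSq] using h1 h3

theorem card_freeRows_add_card {n : ℕ} {d : Fin n → ℕ} {h : ℕ} (hdh : ∀ j, d j ≤ h) (hn : h ≤ n)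
    {C : Finset (Fin n × Fin n)} (hC : C ⊆ boardSq n d) (hC' : NonAttacking C) :
    (freeRows h C).card + C.card = h := by
  have h1 : (C.image Prod.fst).card = C.card := by
    refine card_image_of_injOn fun r hr r' hr' e => ?_
    by_contra hne
    exact (hC' r hr r' hr' hne).1 e
  have h2 : freeRows h C = (univ.filter fun i : Fin n => (i : ℕ) < h) \ C.image Prod.fst := by
    ext i
    simp only [freeRows, mem_filter, mem_univ, true_and, mem_sdiff, mem_image, not_exists, not_and]
  have h3 : C.image Prod.fst ⊆ univ.filter fun i : Fin n => (i : ℕ) < h := by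
    intro i hi
    obtain ⟨r, hr, rfl⟩ := mem_image.mp hi
    simpa using (mem_boardSq.mp (hC hr)).trans_le (hdh _)
  have h4 : (univ.filter fun i : Fin n => (i : ℕ) < h).card = h := by
    rw [Fin.card_filter_val_lt]
    exact min_eq_right hn
  rw [h2, ← h1, card_sdiff_add_card_eq_card h3, h4]

theorem sum_pow_card_filter_lt {K ι : Type*} [CommRing K] [LinearOrder ι] (p : K)
    (S : Finset ι) :
    ∑ i ∈ S, p ^ (S.filter fun j => i < j).card = ∑ t ∈ range S.card, p ^ t := by
  induction S using Finset.induction_on_min with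
  | empty => simp
  | insert a s ha ih =>
    have hs : a ∉ s := fun h => lt_irrefl _ (ha a h)
    rw [sum_insert hs, card_insert_of_notMem hs, sum_range_succ, add_comm, ← ih]
    congr 1
    · refine sum_congr rfl fun i hi => ?_
      rw [filter_insert, if_neg (ha i hi).le.not_gt]
    · rw [filter_insert, if_neg (lt_irrefl a), filter_true_of_mem ha]

end RookSide

section MatrixSide

open Module

variable {F : Type*} [Field F]

theorem finrank_sup_span_singleton_of_notMem {V : Type*} [AddCommGroup V] [Module F V]
    [FiniteDimensional F V] {W : Submodule F V} {v : V} (hv : v ∉ W) :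
    finrank F ↥(W ⊔ Submodule.span F {v}) = finrank F W + 1 := by
  have h0 : v ≠ 0 := fun h => hv (h ▸ W.zero_mem)
  have h1 : W ⊓ Submodule.span F {v} = ⊥ :=
    disjoint_iff.mp ((Submodule.disjoint_span_singleton' h0).mpr hv)
  have h2 := Submodule.finrank_sup_add_finrank_inf_eq W (Submodule.span F {v})
  rwa [h1, finrank_bot, add_zero, finrank_span_singleton h0] at h2

theorem span_range_col_updateCol {m n : Type*} [DecidableEq n] {A : Matrix m n F} {j₀ : n}
    (hA : ∀ i, A i j₀ = 0) (v : m → F) :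
    Submodule.span F (Set.range (A.updateCol j₀ v).col) =
      Submodule.span F (Set.range A.col) ⊔ Submodule.span F {v} := by
  have hcol : (A.updateCol j₀ v).col j₀ = v := by ext i; simp [Matrix.col]
  have hcol' : ∀ j, j ≠ j₀ → (A.updateCol j₀ v).col j = A.col j := by
    intro j hj; ext i; simp [Matrix.col, hj]
  apply le_antisymm
  · rw [Submodule.span_le]
    rintro _ ⟨j, rfl⟩
    by_cases hj : j = j₀
    · rw [hj, hcol]
      exact Submodule.mem_sup_right (Submodule.mem_span_singleton_self v)
    · rw [hcol' j hj]
      exact Submodule.mem_sup_left (Submodule.subset_span ⟨j, rfl⟩)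
  · rw [sup_le_iff, Submodule.span_le, Submodule.span_le]
    constructor
    · rintro _ ⟨j, rfl⟩
      by_cases hj : j = j₀
      · have : A.col j = 0 := by ext i; simp [Matrix.col, hj, hA]
        rw [this]
        exact Submodule.zero_mem _
      · rw [← hcol' j hj]
        exact Submodule.subset_span ⟨j, rfl⟩
    · rw [Set.singleton_subset_iff]
      exact Submodule.subset_span ⟨j₀, hcol⟩

theorem rank_updateCol {m n : Type*} [Fintype m] [Fintype n] [DecidableEq n] {A : Matrix m n F}
    {j₀ : n} (hA : ∀ i, A i j₀ = 0) (v : m → F) :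
    (A.updateCol j₀ v).rank =
      if v ∈ Submodule.span F (Set.range A.col) then A.rank else A.rank + 1 := by
  rw [Matrix.rank_eq_finrank_span_cols, Matrix.rank_eq_finrank_span_cols,
    span_range_col_updateCol hA]
  split_ifs with hv
  · rw [sup_eq_left.mpr ((Submodule.span_singleton_le_iff_mem v _).mpr hv)]
  · exact finrank_sup_span_singleton_of_notMem hv

variable [Fintype F]

/-- The matrices supported on the board with column heights `c`. -/
noncomputable def supportedMatrices (F : Type*) [Field F] [Fintype F] (n : ℕ) (c : Fin n → ℕ) :
    Finset (Matrix (Fin n) (Fin n) F) :=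
  Finset.univ.filter fun A => ∀ i j : Fin n, ¬ ((i : ℕ) < c j) → A i j = 0

/-- The column vectors supported on the first `h` coordinates. -/
noncomputable def supportedVectors (F : Type*) [Field F] [Fintype F] (n h : ℕ) :
    Finset (Fin n → F) :=
  Finset.univ.filter fun v => ∀ i : Fin n, ¬ ((i : ℕ) < h) → v i = 0

theorem card_supportedVectors {n h : ℕ} (hn : h ≤ n) :
    (supportedVectors F n h).card = Fintype.card F ^ h := by
  have : supportedVectors F n h =
      Fintype.piFinset fun i : Fin n => if (i : ℕ) < h then univ else {0} := by
    ext v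
    simp only [supportedVectors, mem_filter, mem_univ, true_and, Fintype.mem_piFinset]
    refine forall_congr' fun i => ?_
    split_ifs with hi <;> simp [hi]
  rw [this, Fintype.card_piFinset]
  simp only [apply_ite Finset.card, card_univ, card_singleton, prod_ite, prod_const, one_pow,
    mul_one]
  rw [Fin.card_filter_val_lt, min_eq_right hn]

theorem sum_supportedMatrices_update {M : Type*} [AddCommMonoid M] {n : ℕ} {d : Fin n → ℕ}
    {j₀ : Fin n} (hd : d j₀ = 0) (h : ℕ) (G : Matrix (Fin n) (Fin n) F → M) :
    ∑ A ∈ supportedMatrices F n (Function.update d j₀ h), G A =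
      ∑ A ∈ supportedMatrices F n d, ∑ v ∈ supportedVectors F n h, G (A.updateCol j₀ v) := by
  rw [← sum_product']
  refine sum_nbij' (fun A => (A.updateCol j₀ 0, fun i => A i j₀))
    (fun x => x.1.updateCol j₀ x.2) ?_ ?_ ?_ ?_ ?_
  · intro A hA
    simp only [supportedMatrices, supportedVectors, mem_product, mem_filter, mem_univ,
      true_and] at hA ⊢
    refine ⟨fun i j hij => ?_, fun i hi => hA i j₀ (by simpa using hi)⟩
    by_cases hj : j = j₀
    · simp [hj]
    · simpa [hj] using hA i j (by simpa [hj] using hij)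
  · rintro ⟨A, v⟩ hA
    simp only [supportedMatrices, supportedVectors, mem_product, mem_filter, mem_univ,
      true_and] at hA ⊢
    intro i j hij
    by_cases hj : j = j₀
    · subst hj
      simpa using hA.2 i (by simpa using hij)
    · simpa [hj] using hA.1 i j (by simpa [hj] using hij)
  · intro A _
    ext i j
    by_cases hj : j = j₀ <;> simp [hj]
  · rintro ⟨A, v⟩ hA
    simp only [supportedMatrices, supportedVectors, mem_product, mem_filter, mem_univ,
      true_and] at hA
    ext i j
    · by_cases hj : j = j₀
      · subst hj
        simpa using (hA.1 i j (by simp [hd])).symm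
      · simp [hj]
    · simp
  · intro A _
    congr 1
    ext i j
    by_cases hj : j = j₀ <;> simp [hj]

theorem sum_rank_updateCol {n h : ℕ} {d : Fin n → ℕ} {j₀ : Fin n} (hd : d j₀ = 0)
    (hdh : ∀ j, d j ≤ h) (hn : h ≤ n) {A : Matrix (Fin n) (Fin n) F}
    (hA : A ∈ supportedMatrices F n d) (f : ℕ → ℚ) :
    ∑ v ∈ supportedVectors F n h, f (A.updateCol j₀ v).rank =
      (Fintype.card F : ℚ) ^ A.rank * f A.rank +
        ((Fintype.card F : ℚ) ^ h - (Fintype.card F : ℚ) ^ A.rank) * f (A.rank + 1) := by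
  simp only [supportedMatrices, mem_filter, mem_univ, true_and] at hA
  have h0 : ∀ i, A i j₀ = 0 := fun i => hA i j₀ (by simp [hd])
  set W := Submodule.span F (Set.range A.col) with hW
  have hsub : univ.filter (· ∈ W) ⊆ supportedVectors F n h := by
    let S : Submodule F (Fin n → F) :=
      { carrier := {v | ∀ i : Fin n, ¬ ((i : ℕ) < h) → v i = 0}
        add_mem' := fun ha hb i hi => by simp [ha i hi, hb i hi]
        zero_mem' := fun _ _ => rfl
        smul_mem' := fun c v hv i hi => by simp [hv i hi] }
    have hWS : W ≤ S := by
      rw [hW, Submodule.span_le]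
      rintro _ ⟨j, rfl⟩ i hi
      exact hA i j fun hij => hi (hij.trans_le (hdh j))
    intro v hv
    simp only [supportedVectors, mem_filter, mem_univ, true_and] at hv ⊢
    exact hWS hv
  have hcard : (univ.filter (· ∈ W)).card = Fintype.card F ^ A.rank := by
    rw [Matrix.rank_eq_finrank_span_cols, ← Module.card_eq_pow_finrank, Fintype.card_subtype]
  have hin : (supportedVectors F n h).filter (· ∈ W) = univ.filter (· ∈ W) := by
    ext v
    simp only [mem_filter, mem_univ, true_and, and_iff_right_iff_imp]
    exact fun hv => hsub (by simpa using hv)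
  have hsum := card_filter_add_card_filter_not (s := supportedVectors F n h) (· ∈ W)
  rw [hin, hcard, card_supportedVectors hn] at hsum
  have hout : (((supportedVectors F n h).filter (· ∉ W)).card : ℚ) =
      (Fintype.card F : ℚ) ^ h - (Fintype.card F : ℚ) ^ A.rank := by
    rw [eq_sub_iff_add_eq']
    exact_mod_cast hsum
  simp only [rank_updateCol h0, apply_ite f]
  rw [sum_ite, sum_const, sum_const, hin, hcard, nsmul_eq_mul, nsmul_eq_mul, hout]
  push_cast
  rfl

end MatrixSide

theorem sum_rank_eq_sum_allPlacements_update {F : Type*} [Field F] [Fintype F] {n h : ℕ}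
    {d : Fin n → ℕ} {j₀ : Fin n} (hd : ∀ j, j₀ ≤ j → d j = 0) (hdh : ∀ j, d j ≤ h) (hn : h ≤ n)
    (ih : ∀ f : ℕ → ℚ, ∑ A ∈ supportedMatrices F n d, f A.rank =
      ∑ C ∈ allPlacements n d, ((Fintype.card F : ℚ) - 1) ^ C.card *
        (Fintype.card F : ℚ) ^ (∑ j, d j) *
        (Fintype.card F : ℚ)⁻¹ ^ (C.card + rookInv n d C) * f C.card) (f : ℕ → ℚ) :
    ∑ A ∈ supportedMatrices F n (Function.update d j₀ h), f A.rank =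
      ∑ C ∈ allPlacements n (Function.update d j₀ h), ((Fintype.card F : ℚ) - 1) ^ C.card *
        (Fintype.card F : ℚ) ^ (∑ j, Function.update d j₀ h j) *
        (Fintype.card F : ℚ)⁻¹ ^ (C.card + rookInv n (Function.update d j₀ h) C) * f C.card := by
  have harea : ∑ j, Function.update d j₀ h j = (∑ j, d j) + h := by
    rw [sum_update_of_mem (mem_univ j₀), add_comm, ← sum_sdiff (subset_univ {j₀}), sum_singleton,
      hd j₀ le_rfl, add_zero]
  rw [sum_supportedMatrices_update (hd j₀ le_rfl), sum_allPlacements_update hd,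
    sum_congr rfl fun A hA => sum_rank_updateCol (hd j₀ le_rfl) hdh hn hA f,
    ih fun r => (Fintype.card F : ℚ) ^ r * f r +
        ((Fintype.card F : ℚ) ^ h - (Fintype.card F : ℚ) ^ r) * f (r + 1)]
  refine sum_congr rfl fun C hC => ?_
  simp only [allPlacements, mem_filter, mem_univ, true_and] at hC
  obtain ⟨hC, hC'⟩ := hC
  have hins : ∀ i, (insert (i, j₀) C).card = C.card + 1 := fun i =>
    card_insert_of_notMem fun hi => lt_irrefl _ (snd_lt_of_mem_boardSq hd (hC hi))
  have hfree := card_freeRows_add_card hdh hn hC hC'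
  simp only [rookInv_update_of_subset hd h hC, rookInv_update_insert hd h hC, hins, harea]
  have hq : (Fintype.card F : ℚ) ≠ 0 := Nat.cast_ne_zero.mpr Fintype.card_ne_zero
  have hgeom : (Fintype.card F : ℚ) ^ (freeRows h C).card * (((Fintype.card F : ℚ) - 1) *
      (Fintype.card F : ℚ)⁻¹ * ∑ t ∈ range (freeRows h C).card, (Fintype.card F : ℚ)⁻¹ ^ t) =
      (Fintype.card F : ℚ) ^ (freeRows h C).card - 1 := by
    have := mul_neg_geom_sum (Fintype.card F : ℚ)⁻¹ (freeRows h C).card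
    rw [show ((Fintype.card F : ℚ) - 1) * (Fintype.card F : ℚ)⁻¹ = 1 - (Fintype.card F : ℚ)⁻¹ by
      field_simp, this, mul_sub, mul_one, ← mul_pow, mul_inv_cancel₀ hq, one_pow]
  have hsum := sum_pow_card_filter_lt (Fintype.card F : ℚ)⁻¹ (freeRows h C)
  generalize (freeRows h C).card = a at hfree hgeom hsum ⊢
  generalize (Fintype.card F : ℚ) = q at *
  generalize rookInv n d C = b at *
  generalize C.card = k at *
  have hterm : ∀ i, (q - 1) ^ (k + 1) * q ^ ((∑ j, d j) + h) *
      q⁻¹ ^ (k + 1 + (b + ((freeRows h C).filter fun i' => i < i').card)) * f (k + 1) =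
      ((q - 1) ^ (k + 1) * q ^ ((∑ j, d j) + h) * q⁻¹ ^ (k + 1 + b) * f (k + 1)) *
        q⁻¹ ^ ((freeRows h C).filter fun i' => i < i').card := fun i => by ring
  rw [sum_congr rfl fun i _ => hterm i, ← mul_sum, hsum]
  subst hfree
  have hqa : q⁻¹ ^ a * q ^ a = 1 := by rw [← mul_pow, inv_mul_cancel₀ hq, one_pow]
  generalize ∑ t ∈ range a, q⁻¹ ^ t = s at *
  calc
    _ = (q - 1) ^ k * q ^ (∑ j, d j) * q⁻¹ ^ (k + b) * q ^ k *
        (f k * 1 + (q ^ a - 1) * f (k + 1)) := by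
      ring
    _ = _ := by
      rw [← hgeom, ← hqa]
      ring

theorem sum_rank_eq_sum_allPlacements {F : Type*} [Field F] [Fintype F] {n : ℕ} {c : Fin n → ℕ}
    (hc : IsFerrers n c) (f : ℕ → ℚ) :
    ∑ A ∈ supportedMatrices F n c, f A.rank =
      ∑ C ∈ allPlacements n c, ((Fintype.card F : ℚ) - 1) ^ C.card *
        (Fintype.card F : ℚ) ^ (∑ j, c j) *
        (Fintype.card F : ℚ)⁻¹ ^ (C.card + rookInv n c C) * f C.card := by
  suffices H : ∀ m ≤ n, ∀ d : Fin n → ℕ, (d = fun j : Fin n => if (j : ℕ) < m then c j else 0) →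
      ∀ f : ℕ → ℚ, ∑ A ∈ supportedMatrices F n d, f A.rank =
        ∑ C ∈ allPlacements n d, ((Fintype.card F : ℚ) - 1) ^ C.card *
          (Fintype.card F : ℚ) ^ (∑ j, d j) *
          (Fintype.card F : ℚ)⁻¹ ^ (C.card + rookInv n d C) * f C.card from
    H n le_rfl c (by simp) f
  intro m
  induction m with
  | zero =>
    rintro - d hd f
    have hd : d = 0 := by rw [hd]; ext j; simp
    subst hd
    have h1 : supportedMatrices F n 0 = {0} := by
      ext A
      simp [supportedMatrices, ← Matrix.ext_iff]
    have hb : boardSq n 0 = ∅ := by simp [boardSq]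
    have h2 : allPlacements n 0 = {∅} := by
      ext C
      simp only [allPlacements, hb, subset_empty, mem_filter, mem_univ, true_and, mem_singleton,
        and_iff_left_iff_imp]
      rintro rfl
      simp [NonAttacking]
    simp [h1, h2, rookInv, hb]
  | succ m ih =>
    intro hm d hd
    have hupd : d = Function.update (fun j : Fin n => if (j : ℕ) < m then c j else 0) ⟨m, hm⟩
        (c ⟨m, hm⟩) := by
      rw [hd]
      ext j
      by_cases hj : j = ⟨m, hm⟩
      · subst hj
        simp
      · have : (j : ℕ) ≠ m := fun e => hj (Fin.ext e)
        rw [Function.update_of_ne hj]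
        exact if_congr (by omega) rfl rfl
    rw [hupd]
    refine sum_rank_eq_sum_allPlacements_update ?_ ?_ (hc.2 _) (ih (by omega) _ rfl)
    · intro j hj
      exact if_neg (not_lt.mpr hj)
    · intro j
      split_ifs with hj
      · exact hc.1 (Fin.le_def.mpr hj.le)
      · exact Nat.zero_le _

theorem statement0 (F : Type*) [Field F] [Fintype F] (n : ℕ) (c : Fin n → ℕ)
    (hc : IsFerrers n c) (k : ℕ) :
    (matCount F n c k : ℚ) =
      ((Fintype.card F : ℚ) - 1) ^ k *
        (Fintype.card F : ℚ) ^ ((∑ j, (c j : ℤ)) - k) *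
        qRook ((Fintype.card F : ℚ))⁻¹ n c k := by
  have key := sum_rank_eq_sum_allPlacements (F := F) hc fun r => if r = k then 1 else 0
  have hq : (Fintype.card F : ℚ) ≠ 0 := Nat.cast_ne_zero.mpr Fintype.card_ne_zero
  have hcount : (matCount F n c k : ℚ) =
      ∑ A ∈ supportedMatrices F n c, if A.rank = k then 1 else 0 := by
    rw [sum_boole, matCount, Nat.card_eq_fintype_card, Fintype.card_subtype, supportedMatrices,
      filter_filter]
    simp only [and_comm]
  have hplace : placements n c k = (allPlacements n c).filter fun C => C.card = k := by
    ext C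
    simp only [placements, allPlacements, mem_filter, mem_univ, true_and]
    tauto
  rw [hcount, key, qRook, hplace, mul_sum, sum_filter]
  refine sum_congr rfl fun C _ => ?_
  split_ifs with hk
  · rw [hk, zpow_sub₀ hq, zpow_natCast, ← Nat.cast_sum, zpow_natCast, pow_add, inv_pow]
    ring
  · simp
end

section
/- The number of n×n upper triangular matrices over F_q of rank k equals (q-1)^k · q^{C(n+1,2)-k} · S_{n+1,n+1-k}(q^{-1}), where S_{n,k}(q) are the q-Stirling numbers of the second kind defined by S_{n+1,k}(q) = q^{k-1} S_{n,k-1}(q) + [k]_q S_{n,k}(q) with S_{0,0}(q)=1 and S_{n,k}(q)=0 for k<0 or k>n. -/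
open Finset
open scoped Classical

/-- The q-Stirling numbers of the second kind:
`S_{n+1,k} = q^{k-1} S_{n,k-1} + [k]_q S_{n,k}`, `S_{0,0} = 1`, `S_{n,k} = 0` out of range. -/
noncomputable def qStirling (q : ℚ) : ℕ → ℕ → ℚ
  | 0, 0 => 1
  | 0, _ + 1 => 0
  | _ + 1, 0 => 0
  | n + 1, k + 1 => q ^ k * qStirling q n k + qint q (k + 1) * qStirling q n (k + 1)

section FlagTuples

variable {F E : Type*} [Field F] [AddCommGroup E] [Module F E] [Fintype E]

lemma qStirling_eq_zero_of_lt (q : ℚ) : ∀ {n k : ℕ}, n < k → qStirling q n k = 0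
  | 0, _ + 1, _ => by simp [qStirling]
  | n + 1, k + 1, h => by
    rw [qStirling, qStirling_eq_zero_of_lt q (n := n) (k := k) (by omega),
      qStirling_eq_zero_of_lt q (n := n) (k := k + 1) (by omega)]
    simp

lemma finrank_sup_span_singleton_eq_ite (W : Submodule F E) (x : E) :
    Module.finrank F ↥(W ⊔ Submodule.span F {x}) =
      if x ∈ W then Module.finrank F W else Module.finrank F W + 1 := by
  split_ifs with hx
  · rw [sup_eq_left.2 (by simpa using hx)]
  · exact Submodule.finrank_sup_span_singleton hx

lemma card_filter_mem_submodule [Fintype F] (W : Submodule F E) :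
    #{x | x ∈ W} = Fintype.card F ^ Module.finrank F W := by
  rw [← Module.card_eq_pow_finrank (K := F) (V := W), Fintype.card_subtype]

/-- The tuples `(v₀, …, vₙ₋₁)` with `vⱼ ∈ V j` that span a space of dimension `k`. -/
noncomputable def flagTuples (V : ℕ → Submodule F E) (n k : ℕ) : Finset (Fin n → E) :=
  {v | (∀ j : Fin n, v j ∈ V j) ∧ Module.finrank F (Submodule.span F (Set.range v)) = k}

lemma mem_flagTuples {V : ℕ → Submodule F E} {n k : ℕ} {v : Fin n → E} :
    v ∈ flagTuples V n k ↔
      (∀ j : Fin n, v j ∈ V j) ∧ Module.finrank F (Submodule.span F (Set.range v)) = k := by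
  simp [flagTuples]

lemma snoc_mem_flagTuples {V : ℕ → Submodule F E} {n k : ℕ} {v : Fin n → E} {x : E} :
    (Fin.snoc v x : Fin (n + 1) → E) ∈ flagTuples V (n + 1) k ↔
      (∀ j : Fin n, v j ∈ V j) ∧ x ∈ V n ∧
        (if x ∈ Submodule.span F (Set.range v)
          then Module.finrank F (Submodule.span F (Set.range v))
          else Module.finrank F (Submodule.span F (Set.range v)) + 1) = k := by
  rw [mem_flagTuples, Fin.range_snoc, Set.insert_eq, Submodule.span_union, sup_comm,
    finrank_sup_span_singleton_eq_ite, Fin.forall_fin_succ']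
  simp [and_assoc]

lemma card_flagTuples_succ (V : ℕ → Submodule F E) (n k : ℕ) :
    #(flagTuples V (n + 1) k) =
      ∑ v : Fin n → E, #{x | (Fin.snoc v x : Fin (n + 1) → E) ∈ flagTuples V (n + 1) k} := by
  simp_rw [card_filter]
  rw [← Fintype.sum_prod_type_right' (fun x v ↦
    if (Fin.snoc v x : Fin (n + 1) → E) ∈ flagTuples V (n + 1) k then 1 else 0),
    ← card_filter]
  refine (card_equiv (Fin.snocEquiv fun _ ↦ E) fun p ↦ ?_).symm
  rw [mem_filter_univ]
  rfl

lemma card_flagTuples_succ_zero (V : ℕ → Submodule F E) (n : ℕ) :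
    #(flagTuples V (n + 1) 0) = #(flagTuples V n 0) := by
  rw [card_flagTuples_succ, card_eq_sum_ones, ← sum_filter_add_sum_filter_not univ
    (· ∈ flagTuples V n 0), filter_mem_eq_inter, univ_inter, add_eq_left.2]
  · refine sum_congr rfl fun v hv ↦ ?_
    obtain ⟨hv, hr⟩ := mem_flagTuples.1 hv
    have hbot := Submodule.finrank_eq_zero.1 hr
    rw [card_eq_one]
    refine ⟨0, ?_⟩
    ext x
    simp only [mem_filter_univ, snoc_mem_flagTuples, mem_singleton, hbot, Submodule.mem_bot]
    constructor
    · rintro ⟨-, -, h⟩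
      by_contra hx
      simp [hx] at h
    · rintro rfl
      refine ⟨hv, zero_mem _, ?_⟩
      rw [if_pos rfl, hr]
  · refine sum_eq_zero fun v hv ↦ ?_
    rw [card_eq_zero, filter_eq_empty_iff]
    rintro x - hx
    rw [snoc_mem_flagTuples] at hx
    obtain ⟨hv', -, h⟩ := hx
    rw [mem_filter_univ, mem_flagTuples] at hv
    split_ifs at h
    exact hv ⟨hv', h⟩

lemma card_flagTuples_succ_succ [Fintype F] {V : ℕ → Submodule F E} (hV : Monotone V) (n k : ℕ) :
    (#(flagTuples V (n + 1) (k + 1)) : ℚ) =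
      (Fintype.card F : ℚ) ^ (k + 1) * #(flagTuples V n (k + 1)) +
        ((Fintype.card F : ℚ) ^ Module.finrank F (V n) - (Fintype.card F : ℚ) ^ k) *
          #(flagTuples V n k) := by
  rw [card_flagTuples_succ, ← filter_univ_mem (flagTuples V n (k + 1)),
    ← filter_univ_mem (flagTuples V n k), card_filter, card_filter]
  push_cast
  rw [mul_sum, mul_sum, ← sum_add_distrib]
  refine sum_congr rfl fun v _ ↦ ?_
  simp only [snoc_mem_flagTuples]
  simp only [mem_flagTuples]
  by_cases hv : ∀ j : Fin n, v j ∈ V j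
  swap
  · simp [hv]
  set W := Submodule.span F (Set.range v) with hW
  have hWV : W ≤ V n := by
    rw [hW, Submodule.span_le]
    rintro _ ⟨j, rfl⟩
    exact hV j.2.le (hv j)
  simp only [hv, true_and, implies_true]
  by_cases h₁ : Module.finrank F W = k + 1
  · have : ({x | x ∈ V n ∧ (if x ∈ W then Module.finrank F W else Module.finrank F W + 1) = k + 1}
        : Finset E) = ({x | x ∈ W} : Finset E) := by
      ext x
      have := @hWV x
      by_cases hx : x ∈ W <;> simp_all
    rw [this, card_filter_mem_submodule, h₁]
    simp
  by_cases h₂ : Module.finrank F W = k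
  · have : ({x | x ∈ V n ∧ (if x ∈ W then Module.finrank F W else Module.finrank F W + 1) = k + 1}
        : Finset E) = ({x | x ∈ V n} : Finset E) \ ({x | x ∈ W} : Finset E) := by
      ext x
      by_cases hx : x ∈ W <;> simp [hx, h₂]
    rw [this, cast_card_sdiff (monotone_filter_right _ fun x _ hx ↦ hWV hx),
      card_filter_mem_submodule, card_filter_mem_submodule, h₂]
    simp
  · have : ({x | x ∈ V n ∧ (if x ∈ W then Module.finrank F W else Module.finrank F W + 1) = k + 1}
        : Finset E) = ∅ := by
      ext x
      by_cases hx : x ∈ W <;> simp [hx, h₁, h₂]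
    simp [this, h₁, h₂]

lemma sub_one_mul_pow_mul_qint_inv {q : ℚ} (hq : q ≠ 0) (m : ℕ) :
    (q - 1) * q ^ m * qint q⁻¹ (m + 1) = q ^ (m + 1) - 1 := by
  induction m with
  | zero => simp [qint]
  | succ m ih =>
    have hcancel : q ^ (m + 1) * q⁻¹ ^ (m + 1) = 1 := by rw [← mul_pow, mul_inv_cancel₀ hq, one_pow]
    rw [qint, sum_range_succ, ← qint]
    linear_combination q * ih + (q - 1) * hcancel

lemma card_flagTuples [Fintype F] {V : ℕ → Submodule F E} (hV : Monotone V) (n k : ℕ) (hk : k ≤ n)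
    (hdim : ∀ j < n, Module.finrank F (V j) = j + 1) :
    (#(flagTuples V n k) : ℚ) =
      ((Fintype.card F : ℚ) - 1) ^ k *
        (Fintype.card F : ℚ) ^ (((n + 1).choose 2 : ℤ) - k) *
        qStirling (Fintype.card F : ℚ)⁻¹ (n + 1) (n + 1 - k) := by
  have hq : (Fintype.card F : ℚ) ≠ 0 := by simp
  induction n generalizing k with
  | zero =>
    obtain rfl : k = 0 := by omega
    have : flagTuples V 0 0 = univ := by ext v; simp [mem_flagTuples, Subsingleton.elim v default]
    simp [this, qStirling]
  | succ n ih =>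
    have hd := hdim n (by omega)
    have ih := fun k hk ↦ ih k hk fun j hj ↦ hdim j (by omega)
    have hchoose : ((n + 1 + 1).choose 2 : ℤ) = (n + 1).choose 2 + (n + 1) := by
      rw [Nat.choose_succ_succ' (n + 1) 1, Nat.choose_one_right]
      push_cast
      ring
    cases k with
    | zero =>
      rw [card_flagTuples_succ_zero, ih 0 (by omega), Nat.sub_zero, Nat.sub_zero,
        qStirling.eq_4 _ (n + 1) (n + 1), qStirling_eq_zero_of_lt _ (Nat.lt_succ_self (n + 1)),
        hchoose]
      simp only [Nat.cast_zero, sub_zero]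
      rw [zpow_add₀ hq, ← Nat.cast_add_one, zpow_natCast, zpow_natCast]
      have hcancel : (Fintype.card F : ℚ) ^ (n + 1) * (Fintype.card F : ℚ)⁻¹ ^ (n + 1) = 1 := by
        rw [← mul_pow, mul_inv_cancel₀ hq, one_pow]
      simp only [pow_zero, one_mul, mul_zero, add_zero]
      linear_combination -(Fintype.card F : ℚ) ^ (n + 1).choose 2 *
        qStirling (Fintype.card F : ℚ)⁻¹ (n + 1) (n + 1) * hcancel
    | succ k =>
      have hkn : k ≤ n := by omega
      obtain ⟨m, rfl⟩ := Nat.exists_eq_add_of_le hkn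
      rw [card_flagTuples_succ_succ hV, hd, ih k hkn, hchoose,
        show k + m + 1 + 1 - (k + 1) = m + 1 by omega, show k + m + 1 - k = m + 1 by omega,
        qStirling.eq_4 _ (k + m + 1) m]
      have hfirst : (#(flagTuples V (k + m) (k + 1)) : ℚ) =
          ((Fintype.card F : ℚ) - 1) ^ (k + 1) *
            (Fintype.card F : ℚ) ^ (((k + m + 1).choose 2 : ℤ) - (k + 1 : ℕ)) *
            qStirling (Fintype.card F : ℚ)⁻¹ (k + m + 1) m := by
        rcases m with _ | m
        · have : flagTuples V (k + 0) (k + 1) = ∅ := by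
            refine eq_empty_of_forall_notMem fun v hv ↦ ?_
            have := finrank_range_le_card (R := F) v
            rw [Set.finrank, (mem_flagTuples.1 hv).2] at this
            simp at this
          rw [this]
          simp [qStirling]
        · rw [ih (k + 1) (by omega), show k + (m + 1) + 1 - (k + 1) = m + 1 by omega]
      have hint := sub_one_mul_pow_mul_qint_inv hq m
      rw [hfirst]
      generalize (Fintype.card F : ℚ) = q at *
      generalize qStirling q⁻¹ (k + m + 1) m = a
      generalize qStirling q⁻¹ (k + m + 1) (m + 1) = b
      generalize ((k + m + 1).choose 2 : ℤ) = c
      have e₁ : q ^ (c + ((k + m : ℕ) + 1 : ℤ) - (k + 1 : ℕ)) =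
          q ^ (c - k) * q ^ (k + m) := by
        rw [← zpow_natCast, ← zpow_add₀ hq]
        congr 1
        push_cast
        ring
      have e₂ : q ^ (c - (k + 1 : ℕ)) = q ^ (c - k) / q := by
        rw [div_eq_mul_inv, ← zpow_sub_one₀ hq]
        congr 1
        push_cast
        ring
      rw [e₁, e₂]
      have e₃ : q ^ (k + m + 1) - q ^ k = q ^ k * ((q - 1) * q ^ m * qint q⁻¹ (m + 1)) := by
        rw [hint]
        ring
      rw [e₃, inv_pow]
      field_simp
      ring

end FlagTuples

/-- The space of vectors in `F ^ m` whose coordinates with index larger than `j` vanish. -/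
def initialCoords (F : Type*) [Field F] (m j : ℕ) : Submodule F (Fin m → F) :=
  ⨅ i ∈ {i : Fin m | j < i}, LinearMap.ker (LinearMap.proj i : (Fin m → F) →ₗ[F] F)

lemma mem_initialCoords {F : Type*} [Field F] {m j : ℕ} {x : Fin m → F} :
    x ∈ initialCoords F m j ↔ ∀ i : Fin m, j < i → x i = 0 := by
  simp [initialCoords]

lemma monotone_initialCoords (F : Type*) [Field F] (m : ℕ) : Monotone (initialCoords F m) :=
  fun _ _ hab _ hx ↦ mem_initialCoords.2 fun i hi ↦ mem_initialCoords.1 hx i (hab.trans_lt hi)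

lemma finrank_initialCoords (F : Type*) [Field F] {m j : ℕ} (hj : j < m) :
    Module.finrank F (initialCoords F m j) = j + 1 := by
  have hcompl : {i : Fin m | j < i} = {i : Fin m | (i : ℕ) ≤ j}ᶜ := by ext; simp
  rw [initialCoords, hcompl, (LinearMap.iInfKerProjEquiv F (fun _ : Fin m ↦ F)
    (disjoint_compl_right (a := {i : Fin m | (i : ℕ) ≤ j})) (by simp)).finrank_eq,
    Module.finrank_fintype_fun_eq_card, Fintype.card_subtype]
  have : ({i | i ∈ {i : Fin m | (i : ℕ) ≤ j}} : Finset (Fin m)) = Iic ⟨j, hj⟩ := by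
    ext; simp [Fin.le_def]
  rw [this, Fin.card_Iic]

theorem statement1 (F : Type*) [Field F] [Fintype F] (n k : ℕ) (hk : k ≤ n) :
    (Nat.card {A : Matrix (Fin n) (Fin n) F //
        A.rank = k ∧ ∀ i j : Fin n, (j : ℕ) < (i : ℕ) → A i j = 0} : ℚ) =
      ((Fintype.card F : ℚ) - 1) ^ k *
        (Fintype.card F : ℚ) ^ (((n + 1).choose 2 : ℤ) - k) *
        qStirling ((Fintype.card F : ℚ))⁻¹ (n + 1) (n + 1 - k) := by
  classical
  rw [← card_flagTuples (monotone_initialCoords F n) n k hk fun j hj ↦ finrank_initialCoords F hj,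
    Nat.card_eq_fintype_card, Fintype.card_subtype]
  congr 1
  refine card_equiv (Matrix.transposeAddEquiv _ _ F).toEquiv fun A ↦ ?_
  rw [mem_filter_univ, mem_flagTuples, A.rank_eq_finrank_span_cols, and_comm]
  refine and_congr ?_ Iff.rfl
  simp only [mem_initialCoords]
  exact forall_comm
end

section
/- For any Ferrers board B with n columns of heights c_1 ≤ ... ≤ c_n, letting P_k(B) be the number of n×n matrices over F_q of rank k supported on B (zero outside B), one has Σ_{k=0}^n (1-x)(1-xq)⋯(1-xq^{k-1}) P_{n-k}(B) = Π_{i=1}^n (q^{c_i} - x q^{i-1}) as an identity of polynomials in x. -/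
open Finset
open scoped Classical

/-- Appending one more vector `v ∈ U` to a family spanning `W ≤ U` multiplies the total weight by
`q ^ dim U - x * q ^ m`. -/
theorem sum_prod_finrank_sup_span_singleton {F V : Type*} [Field F] [Fintype F] [AddCommGroup V]
    [Module F V] [Fintype V] (x : ℚ) {W U : Submodule F V} (hWU : W ≤ U) {m : ℕ}
    (hm : Module.finrank F W ≤ m) :
    ∑ v : U, ∏ j ∈ Finset.range (m + 1 - Module.finrank F ↥(W ⊔ Submodule.span F {(v : V)})),
        (1 - x * (Fintype.card F : ℚ) ^ j) =
      (∏ j ∈ Finset.range (m - Module.finrank F W), (1 - x * (Fintype.card F : ℚ) ^ j)) *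
        ((Fintype.card F : ℚ) ^ Module.finrank F U - x * (Fintype.card F : ℚ) ^ m) := by
  obtain ⟨d, rfl⟩ := Nat.exists_eq_add_of_le hm
  have weight (v : U) :
      ∏ j ∈ Finset.range (Module.finrank F W + d + 1 -
          Module.finrank F ↥(W ⊔ Submodule.span F {(v : V)})),
        (1 - x * (Fintype.card F : ℚ) ^ j) =
      (∏ j ∈ Finset.range d, (1 - x * (Fintype.card F : ℚ) ^ j)) *
        (1 - if (v : V) ∈ W then x * (Fintype.card F : ℚ) ^ d else 0) := by
    split_ifs with hv
    · rw [sup_eq_left.2 ((Submodule.span_singleton_le_iff_mem _ _).2 hv), add_assoc,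
        Nat.add_sub_cancel_left, Finset.prod_range_succ]
    · rw [Submodule.finrank_sup_span_singleton hv, add_right_comm, Nat.add_sub_cancel_left, sub_zero,
        mul_one]
  have card_W : #{v : U | (v : V) ∈ W} = Fintype.card F ^ Module.finrank F W := by
    rw [← Module.card_eq_pow_finrank (K := F) (V := W), ← Fintype.card_subtype]
    exact Fintype.card_congr (Equiv.subtypeSubtypeEquivSubtype fun h => hWU h)
  simp_rw [weight]
  rw [← Finset.mul_sum, Finset.sum_sub_distrib, ← Finset.sum_filter, Finset.sum_const,
    Finset.sum_const, card_W, Finset.card_univ, Module.card_eq_pow_finrank (K := F) (V := U),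
    Nat.add_sub_cancel_left]
  simp only [nsmul_eq_mul]
  push_cast
  ring

/-- The rank enumerator of families of vectors chosen from a chain of subspaces. -/
theorem sum_prod_finrank_span_range {F V : Type*} [Field F] [Fintype F] [AddCommGroup V]
    [Module F V] [Fintype V] (x : ℚ) {m : ℕ} (E : Fin m → Submodule F V) (hE : Monotone E) :
    ∑ f : (∀ i, E i), ∏ j ∈ Finset.range
        (m - Module.finrank F (Submodule.span F (Set.range fun i => (f i : V)))),
        (1 - x * (Fintype.card F : ℚ) ^ j) =
      ∏ i : Fin m, ((Fintype.card F : ℚ) ^ Module.finrank F (E i) -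
        x * (Fintype.card F : ℚ) ^ (i : ℕ)) := by
  induction m with
  | zero => simp
  | succ m ih =>
    rw [← (Fin.snocEquiv fun i => ↥(E i)).sum_comp, Fintype.sum_prod_type_right,
      Fin.prod_univ_castSucc]
    simp only [Fin.val_castSucc, Fin.val_last]
    rw [← ih (fun i => E i.castSucc) fun i j h => hE (Fin.castSucc_le_castSucc_iff.2 h),
      Finset.sum_mul]
    refine Finset.sum_congr rfl fun f _ => ?_
    have range_snoc (v : E (Fin.last m)) :
        Set.range (fun i => ((Fin.snocEquiv (fun i => ↥(E i)) (v, f)) i : V)) =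
          insert (v : V) (Set.range fun i => (f i : V)) := by
      rw [← Fin.range_snoc]
      congr 1
      ext i
      refine Fin.lastCases ?_ (fun i => ?_) i <;> simp [Fin.snocEquiv]
    have finrank_snoc (v : E (Fin.last m)) :
        Module.finrank F (Submodule.span F
          (Set.range fun i => ((Fin.snocEquiv (fun i => ↥(E i)) (v, f)) i : V))) =
        Module.finrank F ↥(Submodule.span F (Set.range fun i => (f i : V)) ⊔
          Submodule.span F {(v : V)}) := by
      rw [range_snoc, Submodule.span_insert, sup_comm]
    simp_rw [finrank_snoc]
    apply sum_prod_finrank_sup_span_singleton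
    · rw [Submodule.span_le]
      rintro _ ⟨i, rfl⟩
      exact hE (Fin.le_last _) (f i).2
    · simpa [Set.finrank] using finrank_range_le_card (R := F) fun i => (f i : V)

theorem mem_spanSubset_setOf_lt {F : Type*} [Field F] {n t : ℕ} {v : Fin n → F} :
    v ∈ Pi.spanSubset F {i : Fin n | (i : ℕ) < t} ↔ ∀ i : Fin n, ¬ (i : ℕ) < t → v i = 0 := by
  rw [Pi.mem_spanSubset_iff]
  rfl

theorem finrank_spanSubset_setOf_lt {F : Type*} [Field F] {n t : ℕ} (ht : t ≤ n) :
    Module.finrank F (Pi.spanSubset F {i : Fin n | (i : ℕ) < t}) = t := by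
  rw [Pi.dim_spanSubset, Set.ncard_eq_toFinset_card']
  simpa using Fin.card_filter_val_lt.trans (min_eq_right ht)

/-- A matrix supported on the board, viewed as the family of its columns. -/
def supportedEquivColumns (F : Type*) [Field F] (n : ℕ) (c : Fin n → ℕ) :
    {A : Matrix (Fin n) (Fin n) F // ∀ i j : Fin n, ¬ ((i : ℕ) < c j) → A i j = 0} ≃
      ∀ j, Pi.spanSubset F {i : Fin n | (i : ℕ) < c j} where
  toFun A j := ⟨fun i => A.1 i j, mem_spanSubset_setOf_lt.2 fun i => A.2 i j⟩
  invFun f := ⟨fun i j => (f j : Fin n → F) i, fun i j => mem_spanSubset_setOf_lt.1 (f j).2 i⟩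
  left_inv _ := rfl
  right_inv _ := rfl

theorem sum_mul_matCount {F : Type*} [Field F] [Fintype F] (n : ℕ) (c : Fin n → ℕ) (g : ℕ → ℚ) :
    ∑ k ∈ Finset.range (n + 1), g k * (matCount F n c (n - k) : ℚ) =
      ∑ A : {A : Matrix (Fin n) (Fin n) F // ∀ i j : Fin n, ¬ ((i : ℕ) < c j) → A i j = 0},
        g (n - A.1.rank) := by
  rw [← Finset.sum_fiberwise_of_maps_to (s := Finset.univ) (t := Finset.range (n + 1))
    (g := fun A => n - A.1.rank) (fun A _ => by simp)]
  refine Finset.sum_congr rfl fun k hk => ?_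
  have hkn : k ≤ n := Nat.lt_succ_iff.1 (Finset.mem_range.1 hk)
  rw [Finset.sum_congr rfl fun A hA => congrArg g (Finset.mem_filter.1 hA).2, Finset.sum_const,
    nsmul_eq_mul, mul_comm, ← Fintype.card_subtype, matCount, Nat.card_eq_fintype_card]
  congr 2
  refine Fintype.card_congr ((Equiv.subtypeSubtypeEquivSubtypeInter _
    fun A : Matrix (Fin n) (Fin n) F => n - A.rank = k).trans
      (Equiv.subtypeEquivRight fun A => ?_)).symm
  have := A.rank_le_width
  rw [and_comm]
  exact and_congr_left' (by omega)

theorem statement3 (F : Type*) [Field F] [Fintype F] (n : ℕ) (c : Fin n → ℕ)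
    (hc : IsFerrers n c) (x : ℚ) :
    ∑ k ∈ Finset.range (n + 1),
        (∏ j ∈ Finset.range k, (1 - x * (Fintype.card F : ℚ) ^ j)) *
          (matCount F n c (n - k) : ℚ) =
      ∏ i : Fin n, ((Fintype.card F : ℚ) ^ (c i) - x * (Fintype.card F : ℚ) ^ (i : ℕ)) := by
  rw [sum_mul_matCount n c fun k => ∏ j ∈ Finset.range k, (1 - x * (Fintype.card F : ℚ) ^ j),
    ← (supportedEquivColumns F n c).symm.sum_comp]
  refine Eq.trans (Finset.sum_congr rfl fun f _ => ?_) ((sum_prod_finrank_span_range x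
    (fun j => Pi.spanSubset F {i : Fin n | (i : ℕ) < c j}) fun j k h v hv => ?_).trans ?_)
  · rw [Matrix.rank_eq_finrank_span_cols]
    rfl
  · rw [mem_spanSubset_setOf_lt] at hv ⊢
    exact fun i hi => hv i fun hlt => hi (hlt.trans_le (hc.1 h))
  · exact Finset.prod_congr rfl fun j _ => by rw [finrank_spanSubset_setOf_lt (hc.2 j)]
end

section
/- Special case of Cauchy's q-binomial theorem: Π_{j=0}^{m-1} (1 + x q^j) = Σ_{k=0}^m [m choose k]_q q^{C(k,2)} x^k, where [m choose k]_q = [m]_q!/([k]_q! [m-k]_q!) and C(k,2) = k(k-1)/2. -/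
open Finset
open scoped Classical

/-- The Gaussian binomial coefficient, defined by the `q`-Pascal recurrence. -/
def gaussBinom {A : Type*} [CommRing A] (q : A) : ℕ → ℕ → A
  | _, 0 => 1
  | 0, _ + 1 => 0
  | m + 1, k + 1 => gaussBinom q m (k + 1) + q ^ (m - k) * gaussBinom q m k

section GaussBinom

variable {A : Type*} [CommRing A] (q : A)

theorem gaussBinom_zero_right (m : ℕ) : gaussBinom q m 0 = 1 := by
  cases m <;> rfl

theorem gaussBinom_succ_succ (m k : ℕ) :
    gaussBinom q (m + 1) (k + 1) = gaussBinom q m (k + 1) + q ^ (m - k) * gaussBinom q m k :=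
  rfl

theorem gaussBinom_eq_zero_of_lt {m k : ℕ} (h : m < k) : gaussBinom q m k = 0 := by
  induction m generalizing k with
  | zero => obtain ⟨k, rfl⟩ := Nat.exists_eq_succ_of_ne_zero h.ne'; rfl
  | succ m ih =>
    obtain ⟨k, rfl⟩ := Nat.exists_eq_succ_of_ne_zero (Nat.ne_zero_of_lt h)
    rw [Nat.succ_eq_add_one, gaussBinom_succ_succ, ih (by omega), ih (by omega)]
    simp

theorem qfact_zero : qfact q 0 = 1 := rfl

theorem qfact_succ (m : ℕ) : qfact q (m + 1) = qfact q m * qint q (m + 1) :=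
  Finset.prod_range_succ _ _

theorem qint_add (a b : ℕ) : qint q (a + b) = qint q a + q ^ a * qint q b := by
  simp only [qint, Finset.sum_range_add, pow_add, Finset.mul_sum]

theorem gaussBinom_add_mul_qfact (a b : ℕ) :
    gaussBinom q (a + b) a * (qfact q a * qfact q b) = qfact q (a + b) := by
  induction h : a + b generalizing a b with
  | zero =>
    obtain ⟨rfl, rfl⟩ := Nat.add_eq_zero_iff.mp h
    simp [qfact_zero, gaussBinom_zero_right]
  | succ m ih =>
    rcases a with _ | a
    · obtain rfl : b = m + 1 := by omega
      simp [qfact_zero, gaussBinom_zero_right]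
    · have hm : m - a = b := by omega
      have hsum : m + 1 = b + (a + 1) := by omega
      have hleft := ih a b (by omega)
      rw [gaussBinom_succ_succ, hm, qfact_succ q m, hsum, qint_add, qfact_succ q a]
      rcases b with _ | b
      · rw [gaussBinom_eq_zero_of_lt q (by omega : m < a + 1)]
        simp only [qint, Finset.range_zero, Finset.sum_empty, pow_zero]
        linear_combination (∑ i ∈ Finset.range (a + 1), q ^ i) * hleft
      · have hright := ih (a + 1) b (by omega)
        rw [qfact_succ] at hright
        rw [qfact_succ q b] at hleft ⊢
        linear_combination qint q (b + 1) * hright + q ^ (b + 1) * qint q (a + 1) * hleft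

theorem prod_one_add_mul_pow (x : A) (m : ℕ) :
    ∏ j ∈ Finset.range m, (1 + x * q ^ j) =
      ∑ k ∈ Finset.range (m + 1), gaussBinom q m k * q ^ (k.choose 2) * x ^ k := by
  induction m with
  | zero => simp [gaussBinom_zero_right]
  | succ m ih =>
    have hterm : ∀ k ∈ Finset.range (m + 1),
        gaussBinom q (m + 1) (k + 1) * q ^ ((k + 1).choose 2) * x ^ (k + 1) =
          gaussBinom q m (k + 1) * q ^ ((k + 1).choose 2) * x ^ (k + 1) +
            gaussBinom q m k * q ^ (k.choose 2) * x ^ k * (x * q ^ m) := by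
      intro k hk
      obtain ⟨d, rfl⟩ := Nat.exists_eq_add_of_le (Nat.lt_succ_iff.mp (Finset.mem_range.mp hk))
      have hchoose : (k + 1).choose 2 = k + k.choose 2 := by
        rw [Nat.choose_succ_succ' k 1, Nat.choose_one_right]
      rw [gaussBinom_succ_succ, hchoose, Nat.add_sub_cancel_left]
      ring
    have hshift := Finset.sum_range_succ'
      (fun k => gaussBinom q m k * q ^ (k.choose 2) * x ^ k) (m + 1)
    rw [Finset.sum_range_succ, gaussBinom_eq_zero_of_lt q m.lt_succ_self] at hshift
    rw [Finset.prod_range_succ, ih, Finset.sum_range_succ' _ (m + 1), Finset.sum_congr rfl hterm,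
      Finset.sum_add_distrib, ← Finset.sum_mul]
    simp only [gaussBinom_zero_right] at hshift ⊢
    linear_combination hshift

end GaussBinom

theorem qfact_ne_zero {q : ℚ} {m : ℕ} (hq : ∀ i, 1 ≤ i → i ≤ m → qint q i ≠ 0) :
    qfact q m ≠ 0 :=
  Finset.prod_ne_zero_iff.mpr fun i hi =>
    hq (i + 1) (Nat.le_add_left 1 i) (Finset.mem_range.mp hi)

theorem statement9 (q : ℚ) (m : ℕ) (hq : ∀ i, 1 ≤ i → i ≤ m → qint q i ≠ 0) (x : ℚ) :
    ∏ j ∈ Finset.range m, (1 + x * q ^ j) =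
      ∑ k ∈ Finset.range (m + 1),
        qfact q m / (qfact q k * qfact q (m - k)) * q ^ (k.choose 2) * x ^ k := by
  rw [prod_one_add_mul_pow]
  refine Finset.sum_congr rfl fun k hk => ?_
  have hkm : k ≤ m := Nat.lt_succ_iff.mp (Finset.mem_range.mp hk)
  have hk0 : qfact q k ≠ 0 := qfact_ne_zero fun i h1 h2 => hq i h1 (h2.trans hkm)
  have hmk0 : qfact q (m - k) ≠ 0 :=
    qfact_ne_zero fun i h1 h2 => hq i h1 (h2.trans (Nat.sub_le m k))
  have hbinom := gaussBinom_add_mul_qfact q k (m - k)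
  rw [Nat.add_sub_cancel' hkm] at hbinom
  rw [eq_div_of_mul_eq (mul_ne_zero hk0 hmk0) hbinom]
end
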